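/- Let V be a Banach 𝕆-bimodule, T a power-associative bounded right para-linear operator on V, and U ⊆ 𝕆 a T-left-admissible domain. Let f = ∑_{i=0}^{7} f_{(i)} •^L e_i be left slice regular on a slice-open set containing the closure of U, with each f_{(i)} slice preserving, and define f*(T)_J := ∑_{i=0}^{7} (f_{(i)}*(T)_J) ⊙ e_i, where f_{(i)}*(T)_J := (1/2π) ∫_{∂(U∩ℂ_J)} (R_s − T)^{⊚−} ⊙ (ds_J f_{(i)}(s)). Then for every J ∈ 𝕊: f*(T)_J = (1/2π) ∫_{∂(U∩ℂ_J)} (R_s − T)^{⊚−} ⊙ (ds_J f(s)) + (1/2π) ∑_{i=1}^{7} ∫_{∂(U∩ℂ_J)} [ (R_s − T)^{⊚−}, ds_J f_{(i)}(s), e_i ]_{𝓑_RO(V)}, where [A, p, q]_{𝓑_RO(V)} := (A ⊙ p) ⊙ q − A ⊙ (pq) is the bimodule associator of 𝓑_RO(V). In particular, if f = f_{(0)} + f_{(1)} •^L J with f_{(0)}, f_{(1)} slice preserving, then f*(T)_J = (1/2π) ∫_{∂(U∩ℂ_J)} (R_s − T)^{⊚−} ⊙ (ds_J f(s)), and for every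 v ∈ Re V, f*(T)_J(v) = (1/2π) ∫_{∂(U∩ℂ_J)} (R_s − T)^{−1}(v) · (ds_J f(s)). -/

import Mathlib

noncomputable section

open scoped BigOperators

/-- Octonions, realized via the Cayley–Dickson doubling of the quaternions. -/
@[ext]
structure Oct : Type where
  a : Quaternion ℝ
  b : Quaternion ℝ

namespace Oct

instance : Zero Oct := ⟨⟨0, 0⟩⟩
instance : Add Oct := ⟨fun x y => ⟨x.a + y.a, x.b + y.b⟩⟩
instance : Neg Oct := ⟨fun x => ⟨-x.a, -x.b⟩⟩
instance : Sub Oct := ⟨fun x y => ⟨x.a - y.a, x.b - y.b⟩⟩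
instance : SMul ℕ Oct := ⟨fun n x => ⟨n • x.a, n • x.b⟩⟩
instance : SMul ℤ Oct := ⟨fun n x => ⟨n • x.a, n • x.b⟩⟩
instance : SMul ℝ Oct := ⟨fun r x => ⟨r • x.a, r • x.b⟩⟩

def toLp (x : Oct) : WithLp 2 (Quaternion ℝ × Quaternion ℝ) :=
  (WithLp.equiv 2 (Quaternion ℝ × Quaternion ℝ)).symm (x.a, x.b)

lemma toLp_injective : Function.Injective toLp := by
  rintro ⟨xa, xb⟩ ⟨ya, yb⟩ h
  have ha : xa = ya :=
    congrArg (fun z => (WithLp.equiv 2 (Quaternion ℝ × Quaternion ℝ) z).1) h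
  have hb : xb = yb :=
    congrArg (fun z => (WithLp.equiv 2 (Quaternion ℝ × Quaternion ℝ) z).2) h
  subst ha; subst hb; rfl

instance : AddCommGroup Oct :=
  toLp_injective.addCommGroup toLp rfl (fun _ _ => rfl) (fun _ => rfl) (fun _ _ => rfl)
    (fun _ _ => rfl) (fun _ _ => rfl)

def toLpHom : Oct →+ WithLp 2 (Quaternion ℝ × Quaternion ℝ) where
  toFun := toLp
  map_zero' := rfl
  map_add' _ _ := rfl

instance : Module ℝ Oct := toLp_injective.module ℝ toLpHom fun _ _ => rfl

instance : NormedAddCommGroup Oct :=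
  NormedAddCommGroup.induced Oct (WithLp 2 (Quaternion ℝ × Quaternion ℝ)) toLpHom toLp_injective

instance : NormedSpace ℝ Oct := ⟨fun r x => norm_smul_le r (toLp x)⟩

def toProdLin : Oct →ₗ[ℝ] Quaternion ℝ × Quaternion ℝ where
  toFun x := (x.a, x.b)
  map_add' _ _ := rfl
  map_smul' _ _ := rfl

lemma toProdLin_injective : Function.Injective toProdLin := by
  rintro ⟨xa, xb⟩ ⟨ya, yb⟩ h
  have ha : xa = ya := congrArg Prod.fst h
  have hb : xb = yb := congrArg Prod.snd h
  subst ha; subst hb; rfl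

instance : FiniteDimensional ℝ Oct :=
  FiniteDimensional.of_injective toProdLin toProdLin_injective

instance : CompleteSpace Oct := FiniteDimensional.complete ℝ Oct

instance : One Oct := ⟨⟨1, 0⟩⟩

instance : Mul Oct :=
  ⟨fun x y => ⟨x.a * y.a - star y.b * x.b, y.b * x.a + x.b * star y.a⟩⟩

/-- Octonionic conjugation. -/
def conj (x : Oct) : Oct := ⟨star x.a, -x.b⟩

/-- The real part of an octonion. -/
def re (x : Oct) : ℝ := x.a.re

/-- Powers of an octonion (association chosen on the left factor). -/
def opow (s : Oct) : ℕ → Oct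
  | 0 => 1
  | n + 1 => s * opow s n

/-- The inverse of a nonzero octonion. -/
def oinv (s : Oct) : Oct := (‖s‖ ^ 2)⁻¹ • conj s

/-- `invPow s n` is the octonion `s ^ (-1 - n)`. -/
def invPow (s : Oct) (n : ℕ) : Oct := opow (oinv s) (n + 1)

def eNat : ℕ → Oct
  | 0 => ⟨1, 0⟩
  | 1 => ⟨⟨0, 1, 0, 0⟩, 0⟩
  | 2 => ⟨⟨0, 0, 1, 0⟩, 0⟩
  | 3 => ⟨⟨0, 0, 0, 1⟩, 0⟩
  | 4 => ⟨0, 1⟩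
  | 5 => ⟨0, ⟨0, 1, 0, 0⟩⟩
  | 6 => ⟨0, ⟨0, 0, 1, 0⟩⟩
  | 7 => ⟨0, ⟨0, 0, 0, 1⟩⟩
  | _ => 0

/-- The standard basis `e_0 = 1, e_1, …, e_7` of the octonions. -/
def e (i : Fin 8) : Oct := eNat i.val

/-- The six-dimensional sphere `𝕊` of imaginary units of `𝕆`. -/
def unitSphere : Set Oct := {J | J * J = -1}

/-- The slice `ℂ_J = ℝ ⊕ ℝJ` of the octonions. -/
def sliceC (J : Oct) : Set Oct := {s | ∃ x y : ℝ, s = x • (1 : Oct) + y • J}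

/-- The embedding of `ℂ` onto the slice `ℂ_J`, `x + y i ↦ x + y J`. -/
def toSlice (J : Oct) (z : ℂ) : Oct := z.re • (1 : Oct) + z.im • J

end Oct

open Oct

/-- A (normed/Banach) `𝕆`-bimodule: a real normed space with continuous real-bilinear left and
right octonionic multiplications satisfying the alternativity relations
`[p,q,x] = [q,x,p] = [x,p,q] = -[q,p,x]` and the norm identities `‖px‖ = |p|‖x‖ = ‖xp‖`. -/
class OctBimodule (V : Type*) [NormedAddCommGroup V] [NormedSpace ℝ V] : Type _ where
  lm : Oct →ₗ[ℝ] V →L[ℝ] V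
  rm : Oct →ₗ[ℝ] V →L[ℝ] V
  lm_one : ∀ x : V, lm 1 x = x
  rm_one : ∀ x : V, rm 1 x = x
  /-- `[p,q,x] = [q,x,p]` -/
  assoc_cyc₁ : ∀ (p q : Oct) (x : V),
    lm (p * q) x - lm p (lm q x) = rm p (lm q x) - lm q (rm p x)
  /-- `[p,q,x] = [x,p,q]` -/
  assoc_cyc₂ : ∀ (p q : Oct) (x : V),
    lm (p * q) x - lm p (lm q x) = rm q (rm p x) - rm (p * q) x
  /-- `[p,q,x] = -[q,p,x]` -/
  assoc_alt : ∀ (p q : Oct) (x : V),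
    lm (p * q) x - lm p (lm q x) = -(lm (q * p) x - lm q (lm p x))
  norm_lm : ∀ (p : Oct) (x : V), ‖lm p x‖ = ‖p‖ * ‖x‖
  norm_rm : ∀ (p : Oct) (x : V), ‖rm p x‖ = ‖p‖ * ‖x‖

section OctMod

variable {V : Type*} [NormedAddCommGroup V] [NormedSpace ℝ V] [OctBimodule V]

/-- Left multiplication `x ↦ p x` as a bounded real-linear operator. -/
def lmo (p : Oct) : V →L[ℝ] V := OctBimodule.lm p

/-- Right multiplication `R_p : x ↦ x p` as a bounded real-linear operator. -/
def rmo (p : Oct) : V →L[ℝ] V := OctBimodule.rm p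

variable (V)

/-- The real-part projection `Re x = (5/12) x - (1/12) ∑_{i=1}^7 e_i x e_i` of an
`𝕆`-bimodule. -/
def reO : V →L[ℝ] V :=
  (5 / 12 : ℝ) • ContinuousLinearMap.id ℝ V -
    (1 / 12 : ℝ) • ∑ i : Fin 7, (rmo (e i.succ)).comp (lmo (e i.succ))

/-- The real part `Re V` of an `𝕆`-bimodule, i.e. the set of associative central elements. -/
def ReSet : Set V :=
  {m | (∀ p q : Oct, lmo (p * q) m = lmo p (lmo q m)) ∧ ∀ p : Oct, lmo p m = rmo p m}

/-- The slice `ℂ_J(V) = Re V ⊕ J · Re V` of an `𝕆`-bimodule. -/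
def CJV (J : Oct) : Set V :=
  {x | ∃ u ∈ ReSet V, ∃ w ∈ ReSet V, x = u + lmo J w}

/-- The slice projection `π_J(x) = Re x + J Re (J̄ x)`. -/
def piJ (J : Oct) : V →L[ℝ] V :=
  reO V + (lmo J).comp ((reO V).comp (lmo (Oct.conj J)))

variable {V}

/-- The second right associator `B_p(T, x) = T(x) p - T(x p)` of an operator. -/
def Bop (p : Oct) (T : V →L[ℝ] V) : V →L[ℝ] V := (rmo p).comp T - T.comp (rmo p)

/-- A bounded real-linear operator is right (octonionic) para-linear if `Re B_p(T,x) = 0`. -/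
def IsRightPara (T : V →L[ℝ] V) : Prop := ∀ (p : Oct) (x : V), reO V (Bop p T x) = 0

/-- The left octonionic scalar multiplication `(p ⊙ T)(x) = p T(x) + B_p(T,x)` on operators. -/
def odotL (p : Oct) (T : V →L[ℝ] V) : V →L[ℝ] V := (lmo p).comp T + Bop p T

/-- The right octonionic scalar multiplication `(T ⊙ p)(x) = T(p x) - B_p(T,x)` on operators. -/
def odotR (T : V →L[ℝ] V) (p : Oct) : V →L[ℝ] V := T.comp (lmo p) - Bop p T

/-- The lifting map, `(lif F)(x) = ∑_i F(x ē_i) e_i`. -/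
def lifO (F : V →L[ℝ] V) : V →L[ℝ] V :=
  ∑ i : Fin 8, (rmo (e i)).comp (F.comp (rmo (Oct.conj (e i))))

/-- The extension map, `(ext G)(∑ x_i e_i) = ∑ G(x_i) e_i`, where `x_i = Re (x ē_i)`. -/
def extO (G : V →L[ℝ] V) : V →L[ℝ] V :=
  ∑ i : Fin 8, (rmo (e i)).comp (G.comp ((reO V).comp (rmo (Oct.conj (e i)))))

/-- The left regular power `T^{n⊚} = lif (Re ∘ Tⁿ)`. -/
def rpowL (T : V →L[ℝ] V) (n : ℕ) : V →L[ℝ] V := lifO ((reO V).comp (T ^ n))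

/-- The right regular power `T^{⊚n} = ext (Tⁿ|_{Re V})`. -/
def rpowR (T : V →L[ℝ] V) (n : ℕ) : V →L[ℝ] V := extO (T ^ n)

/-- The regular composition `f ⊚ g = lif (Re ∘ f ∘ g)`. -/
def rcomp (f g : V →L[ℝ] V) : V →L[ℝ] V := lifO ((reO V).comp (f.comp g))

/-- The composition associator `[f,g,x]_⊚ = (f ⊚ g)(x) - f(g(x))`. -/
def compAssoc (f g : V →L[ℝ] V) (x : V) : V := rcomp f g x - f (g x)

/-- The right regular inverse `T^{⊚-} = ext (T⁻¹|_{Re V})` of an invertible operator. -/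
def rinvR (T : V →L[ℝ] V) : V →L[ℝ] V := extO (Ring.inverse T)

/-- The left regular inverse `T^{-⊚} = lif (Re ∘ T⁻¹)` of an invertible operator. -/
def rinvL (T : V →L[ℝ] V) : V →L[ℝ] V := lifO ((reO V).comp (Ring.inverse T))

/-- An operator is power-associative if all of its (composition) powers are right
para-linear. -/
def IsPowerAssoc (T : V →L[ℝ] V) : Prop := ∀ n : ℕ, IsRightPara (T ^ n)

/-- A bounded operator is octonionic linear if `T(xp) = T(x)p` for all `p`. -/
def IsOctLinear (T : V →L[ℝ] V) : Prop := ∀ (p : Oct) (x : V), T (rmo p x) = rmo p (T x)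

/-- `S` is `ℂ_J`-extendable power associative: `Sⁿ(v s) = Sⁿ(v) s` for `v ∈ Re V`,
`s ∈ ℂ_J`, `n ≥ 1`. -/
def CJExtPA (J : Oct) (S : V →L[ℝ] V) : Prop :=
  ∀ n : ℕ, 1 ≤ n → ∀ v ∈ ReSet V, ∀ s ∈ sliceC J, (S ^ n) (rmo s v) = rmo s ((S ^ n) v)

/-- `S` is `ℂ_J`-liftable power associative: `Re (Sⁿ(v s)) = Re (Sⁿ(v) s)` for all `v ∈ V`,
`s ∈ ℂ_J`, `n ≥ 1`. -/
def CJLiftPA (J : Oct) (S : V →L[ℝ] V) : Prop :=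
  ∀ n : ℕ, 1 ≤ n → ∀ (v : V), ∀ s ∈ sliceC J,
    reO V ((S ^ n) (rmo s v)) = reO V (rmo s ((S ^ n) v))

/-- The pull-back slice-resolvent set `ρ*_J(T)`. -/
def pbResSlice (T : V →L[ℝ] V) (J : Oct) : Set Oct :=
  {s | s ∈ sliceC J ∧ IsUnit ((rmo s : V →L[ℝ] V) - T) ∧
    CJExtPA J (Ring.inverse ((rmo s : V →L[ℝ] V) - T))}

/-- The pull-back resolvent set `ρ*(T)`. -/
def pbRes (T : V →L[ℝ] V) : Set Oct := ⋃ J ∈ unitSphere, pbResSlice T J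

/-- The pull-back spectrum `σ*(T) = 𝕆 ∖ ρ*(T)`. -/
def pbSpec (T : V →L[ℝ] V) : Set Oct := Set.univ \ pbRes T

/-- The push-forward slice-resolvent set `ρ_{*J}(T)`. -/
def pfResSlice (T : V →L[ℝ] V) (J : Oct) : Set Oct :=
  {s | s ∈ sliceC J ∧ IsUnit ((rmo s : V →L[ℝ] V) - T) ∧
    CJLiftPA J (Ring.inverse ((rmo s : V →L[ℝ] V) - T))}

/-- The push-forward resolvent set `ρ_*(T)`. -/
def pfRes (T : V →L[ℝ] V) : Set Oct := ⋃ J ∈ unitSphere, pfResSlice T J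

/-- The push-forward spectrum `σ_*(T) = 𝕆 ∖ ρ_*(T)`. -/
def pfSpec (T : V →L[ℝ] V) : Set Oct := Set.univ \ pfRes T

/-- The real-part projection of the `𝕆`-bimodule `𝓑_RO(V)` of bounded right para-linear
operators, given by `Re A = (5/12) A - (1/12) ∑_{i=1}^7 (e_i ⊙ A) ⊙ e_i`. -/
def reOpB (A : V →L[ℝ] V) : V →L[ℝ] V :=
  (5 / 12 : ℝ) • A - (1 / 12 : ℝ) • ∑ i : Fin 7, odotR (odotL (e i.succ) A) (e i.succ)

end OctMod

/-- A set `U ⊆ 𝕆` is slice-open if `U ∩ ℂ_J` is open in `ℂ_J` for every `J ∈ 𝕊`. -/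
def SliceOpen (U : Set Oct) : Prop :=
  ∀ J ∈ unitSphere, IsOpen (Oct.toSlice J ⁻¹' U)

/-- A parametrization of the boundary `∂(U ∩ ℂ_J)` by finitely many continuously
differentiable, positively oriented Jordan curves (positivity of the orientation is encoded
through the winding numbers). -/
structure SliceContour (J : Oct) (U : Set Oct) where
  n : ℕ
  γ : Fin n → ℝ → ℂ
  smooth : ∀ i, ContDiff ℝ 1 (γ i)
  closed : ∀ i, γ i 0 = γ i 1
  jordan : ∀ i, Set.InjOn (γ i) (Set.Ico (0 : ℝ) 1)
  image_eq : (⋃ i, γ i '' Set.Icc (0 : ℝ) 1) = frontier (Oct.toSlice J ⁻¹' U)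
  winding_inside : ∀ z : ℂ, Oct.toSlice J z ∈ U →
    (∑ i, ∫ t in (0 : ℝ)..1, deriv (γ i) t / (γ i t - z)) = 2 * (Real.pi : ℂ) * Complex.I
  winding_outside : ∀ z : ℂ, Oct.toSlice J z ∉ closure U →
    (∑ i, ∫ t in (0 : ℝ)..1, deriv (γ i) t / (γ i t - z)) = 0

/-- The integral `∫_{∂(U ∩ ℂ_J)} Φ(s, ds)` along a slice contour: the integrand gets the
point of the curve and its derivative (both in the coordinates of the slice). -/
def contourSum {J : Oct} {U : Set Oct} (Γ : SliceContour J U) {E : Type*}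
    [NormedAddCommGroup E] [NormedSpace ℝ E] (Φ : ℂ → ℂ → E) : E :=
  ∑ i, ∫ t in (0 : ℝ)..1, Φ (Γ.γ i t) (deriv (Γ.γ i) t)

/-- An axially symmetric slice domain (s-domain) in `𝕆`. -/
structure IsAdmissibleDomain (U : Set Oct) : Prop where
  isOpen : IsOpen U
  isConnected : IsConnected U
  real_nonempty : (U ∩ {s : Oct | ∃ r : ℝ, s = r • (1 : Oct)}).Nonempty
  axially : ∀ (z : ℂ), ∀ I ∈ unitSphere, ∀ J ∈ unitSphere,
    Oct.toSlice I z ∈ U → Oct.toSlice J z ∈ U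
  slice_conn : ∀ J ∈ unitSphere, IsConnected (Oct.toSlice J ⁻¹' U)

section Adm

variable {V : Type*} [NormedAddCommGroup V] [NormedSpace ℝ V] [OctBimodule V]

/-- A `T`-left-admissible domain: an axially symmetric s-domain containing the pull-back
spectrum `σ*(T)`.  (The regularity of its slice boundaries is witnessed by the slice
contours used in the integrals.) -/
def LeftAdmissible (T : V →L[ℝ] V) (U : Set Oct) : Prop :=
  IsAdmissibleDomain U ∧ pbSpec T ⊆ U

/-- A `T`-right-admissible domain: an axially symmetric s-domain containing the push-forward
spectrum `σ_*(T)`. -/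
def RightAdmissible (T : V →L[ℝ] V) (U : Set Oct) : Prop :=
  IsAdmissibleDomain U ∧ pfSpec T ⊆ U

end Adm

/-- The axially symmetric set `Ω_D ⊆ 𝕆` induced by a conjugation-invariant set `D ⊆ ℂ`. -/
def OmegaD (D : Set ℂ) : Set Oct := ⋃ J ∈ unitSphere, Oct.toSlice J '' D

/-- `F` is the stem of a slice preserving slice regular function on `Ω_D`: it is holomorphic
on the open conjugation-invariant set `D` and intertwines complex conjugation. -/
structure IsStem (D : Set ℂ) (F : ℂ → ℂ) : Prop where
  isOpen : IsOpen D
  conj_mem : ∀ z ∈ D, (starRingEnd ℂ) z ∈ D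
  holo : DifferentiableOn ℂ F D
  conj_comm : ∀ z ∈ D, F ((starRingEnd ℂ) z) = (starRingEnd ℂ) (F z)

section FC

variable {V : Type*} [NormedAddCommGroup V] [NormedSpace ℝ V] [OctBimodule V]

/-- The slice integral `(1/2π) ∫_{∂(U∩ℂ_J)} (R_s - T)^{⊚-} ⊙ (ds_J f(s))` defining the left
slice regular functional calculus of a slice preserving function with stem `F`. -/
def leftFC (T : V →L[ℝ] V) (J : Oct) {U : Set Oct} (Γ : SliceContour J U)
    (F : ℂ → ℂ) : V →L[ℝ] V :=
  (2 * Real.pi)⁻¹ • contourSum Γ fun z dz =>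
    odotR (rinvR ((rmo (Oct.toSlice J z) : V →L[ℝ] V) - T))
      ((-(Oct.toSlice J dz) * J) * Oct.toSlice J (F z))

/-- The slice integral `(1/2π) ∫_{∂(U∩ℂ_J)} (f(s) ds_J) ⊙ (R_s - T)^{-⊚}` defining the right
slice regular functional calculus of a slice preserving function with stem `F`. -/
def rightFC (T : V →L[ℝ] V) (J : Oct) {U : Set Oct} (Γ : SliceContour J U)
    (F : ℂ → ℂ) : V →L[ℝ] V :=
  (2 * Real.pi)⁻¹ • contourSum Γ fun z dz =>
    odotL (Oct.toSlice J (F z) * (-(Oct.toSlice J dz) * J))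
      (rinvL ((rmo (Oct.toSlice J z) : V →L[ℝ] V) - T))

end FC

/-- The family of stems of the components, relative to `J = ∑ c_i e_i`, of a function of the
form `f₀ + f₁ • J` with `f₀, f₁` slice preserving with stems `F₀, F₁`. -/
def stemFamily (c : Fin 8 → ℝ) (F₀ F₁ : ℂ → ℂ) : Fin 8 → ℂ → ℂ :=
  fun i z => if i = 0 then F₀ z else (c i : ℂ) * F₁ z

namespace Oct

/-- Left multiplication by an octonion, as a real-linear map. -/
def lmulLin (q : Oct) : Oct →ₗ[ℝ] Oct where
  toFun x := q * x
  map_add' x y := by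
    refine Oct.ext ?_ ?_
    · show q.a * (x.a + y.a) - star (x.b + y.b) * q.b =
        (q.a * x.a - star x.b * q.b) + (q.a * y.a - star y.b * q.b)
      rw [mul_add, star_add, add_mul]; abel
    · show (x.b + y.b) * q.a + q.b * star (x.a + y.a) =
        (x.b * q.a + q.b * star x.a) + (y.b * q.a + q.b * star y.a)
      rw [add_mul, star_add, mul_add]; abel
  map_smul' r x := by
    refine Oct.ext ?_ ?_
    · show q.a * (r • x.a) - star (r • x.b) * q.b = r • (q.a * x.a - star x.b * q.b)
      rw [mul_smul_comm, Quaternion.star_smul, smul_mul_assoc, smul_sub]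
    · show (r • x.b) * q.a + q.b * star (r • x.a) = r • (x.b * q.a + q.b * star x.a)
      rw [smul_mul_assoc, Quaternion.star_smul, mul_smul_comm, smul_add]

/-- Left multiplication `L_q : x ↦ q x` as a bounded real-linear operator on `𝕆`. -/
def Lq (q : Oct) : Oct →L[ℝ] Oct := (lmulLin q).toContinuousLinearMap

/-- The two-sphere `[q] = {Re q + |Im q| J : J ∈ 𝕊}` associated with an octonion `q`. -/
def qSphere (q : Oct) : Set Oct :=
  {s | ∃ J ∈ unitSphere, s = Oct.re q • (1 : Oct) + ‖q - Oct.re q • (1 : Oct)‖ • J}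

end Oct

namespace Oct

open scoped Quaternion

@[simp] lemma zero_a : (0 : Oct).a = 0 := rfl
@[simp] lemma zero_b : (0 : Oct).b = 0 := rfl
@[simp] lemma one_a : (1 : Oct).a = 1 := rfl
@[simp] lemma one_b : (1 : Oct).b = 0 := rfl
@[simp] lemma add_a (x y : Oct) : (x + y).a = x.a + y.a := rfl
@[simp] lemma add_b (x y : Oct) : (x + y).b = x.b + y.b := rfl
@[simp] lemma neg_a (x : Oct) : (-x).a = -x.a := rfl
@[simp] lemma neg_b (x : Oct) : (-x).b = -x.b := rfl
@[simp] lemma sub_a (x y : Oct) : (x - y).a = x.a - y.a := rfl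
@[simp] lemma sub_b (x y : Oct) : (x - y).b = x.b - y.b := rfl
@[simp] lemma smul_a (r : ℝ) (x : Oct) : (r • x).a = r • x.a := rfl
@[simp] lemma smul_b (r : ℝ) (x : Oct) : (r • x).b = r • x.b := rfl
@[simp] lemma mul_a (x y : Oct) : (x * y).a = x.a * y.a - star y.b * x.b := rfl
@[simp] lemma mul_b (x y : Oct) : (x * y).b = y.b * x.a + x.b * star y.a := rfl
@[simp] lemma conj_a (x : Oct) : (conj x).a = star x.a := rfl
@[simp] lemma conj_b (x : Oct) : (conj x).b = -x.b := rfl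

/-- The ring structure of `𝕆`, kept out of the global instances so that the operations on `𝕆`
keep elaborating to the instances they were defined with. -/
abbrev nonAssocRing : NonAssocRing Oct :=
  { (inferInstance : AddCommGroup Oct), (inferInstance : Mul Oct), (inferInstance : One Oct) with
    left_distrib := fun x y z => by
      ext1 <;> simp [mul_add, add_mul] <;> abel
    right_distrib := fun x y z => by
      ext1 <;> simp [mul_add, add_mul] <;> abel
    zero_mul := fun x => by ext1 <;> simp
    mul_zero := fun x => by ext1 <;> simp
    one_mul := fun x => by ext1 <;> simp
    mul_one := fun x => by ext1 <;> simp }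

end Oct

section OctonionRing

attribute [local instance] Oct.nonAssocRing

namespace Oct

open scoped Quaternion

instance : IsScalarTower ℝ Oct Oct :=
  ⟨fun r x y => by ext1 <;> simp [smul_sub, smul_add]⟩

instance : SMulCommClass ℝ Oct Oct :=
  ⟨fun r x y => by ext1 <;> simp [smul_sub, smul_add]⟩

lemma left_alternative (x y : Oct) : x * (x * y) = x * x * y := by
  ext <;> simp <;> ring

lemma right_alternative (x y : Oct) : y * x * x = y * (x * x) := by
  ext <;> simp <;> ring

lemma re_mul_assoc (x y z : Oct) : re (x * y * z) = re (x * (y * z)) := by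
  simp [re]; ring

lemma re_mul_comm (x y : Oct) : re (x * y) = re (y * x) := by
  simp [re]; ring

/-- The quaternion units `i`, `j`, `k`. -/
def qi : Quaternion ℝ := ⟨0, 1, 0, 0⟩
def qj : Quaternion ℝ := ⟨0, 0, 1, 0⟩
def qk : Quaternion ℝ := ⟨0, 0, 0, 1⟩

@[simp] lemma qi_re : qi.re = 0 := rfl
@[simp] lemma qi_imI : qi.imI = 1 := rfl
@[simp] lemma qi_imJ : qi.imJ = 0 := rfl
@[simp] lemma qi_imK : qi.imK = 0 := rfl
@[simp] lemma qj_re : qj.re = 0 := rfl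
@[simp] lemma qj_imI : qj.imI = 0 := rfl
@[simp] lemma qj_imJ : qj.imJ = 1 := rfl
@[simp] lemma qj_imK : qj.imK = 0 := rfl
@[simp] lemma qk_re : qk.re = 0 := rfl
@[simp] lemma qk_imI : qk.imI = 0 := rfl
@[simp] lemma qk_imJ : qk.imJ = 0 := rfl
@[simp] lemma qk_imK : qk.imK = 1 := rfl

lemma e_zero : e 0 = ⟨1, 0⟩ := rfl
lemma e_one : e 1 = ⟨qi, 0⟩ := rfl
lemma e_two : e 2 = ⟨qj, 0⟩ := rfl
lemma e_three : e 3 = ⟨qk, 0⟩ := rfl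
lemma e_four : e 4 = ⟨0, 1⟩ := rfl
lemma e_five : e 5 = ⟨0, qi⟩ := rfl
lemma e_six : e 6 = ⟨0, qj⟩ := rfl
lemma e_seven : e 7 = ⟨0, qk⟩ := rfl

lemma sum_re_mul_smul_conj (q : Oct) : ∑ j : Fin 8, re (q * e j) • conj (e j) = q := by
  simp only [Fin.sum_univ_eight, e_zero, e_one, e_two, e_three, e_four, e_five, e_six, e_seven]
  ext <;> simp [re]

lemma sum_re_conj_mul_smul (q : Oct) : ∑ j : Fin 8, re (conj (e j) * q) • e j = q := by
  simp only [Fin.sum_univ_eight, e_zero, e_one, e_two, e_three, e_four, e_five, e_six, e_seven]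
  ext <;> simp [re]

end Oct

section OperatorIdentities

variable {V : Type*} [NormedAddCommGroup V] [NormedSpace ℝ V] [OctBimodule V]

lemma lmo_one : (lmo 1 : V →L[ℝ] V) = 1 := by ext x; exact OctBimodule.lm_one x
lemma rmo_one : (rmo 1 : V →L[ℝ] V) = 1 := by ext x; exact OctBimodule.rm_one x
lemma lmo_add (p q : Oct) : (lmo (p + q) : V →L[ℝ] V) = lmo p + lmo q := map_add OctBimodule.lm p q
lemma rmo_add (p q : Oct) : (rmo (p + q) : V →L[ℝ] V) = rmo p + rmo q := map_add OctBimodule.rm p q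
lemma lmo_neg (p : Oct) : (lmo (-p) : V →L[ℝ] V) = -lmo p := map_neg OctBimodule.lm p
lemma rmo_neg (p : Oct) : (rmo (-p) : V →L[ℝ] V) = -rmo p := map_neg OctBimodule.rm p
lemma lmo_smul (r : ℝ) (p : Oct) : (lmo (r • p) : V →L[ℝ] V) = r • lmo p :=
  map_smul OctBimodule.lm r p
lemma rmo_smul (r : ℝ) (p : Oct) : (rmo (r • p) : V →L[ℝ] V) = r • rmo p :=
  map_smul OctBimodule.rm r p

/-- The relation `[p, q, x] = [x, p, q]` between multiplication operators. -/
lemma lmo_mul_add_rmo_mul (p q : Oct) :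
    (lmo (p * q) + rmo (p * q) : V →L[ℝ] V) = lmo p * lmo q + rmo q * rmo p := by
  ext x
  have h := OctBimodule.assoc_cyc₂ p q x
  rw [sub_eq_sub_iff_add_eq_add, add_comm (OctBimodule.rm q _)] at h
  exact h

/-- The relation `[p, q, x] = [q, x, p]` between multiplication operators. -/
lemma lmo_mul_sub (p q : Oct) :
    (lmo (p * q) - lmo p * lmo q : V →L[ℝ] V) = rmo p * lmo q - lmo q * rmo p := by
  ext x
  exact OctBimodule.assoc_cyc₁ p q x

lemma lmo_mul_add_lmo_mul (p q : Oct) :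
    (lmo p * lmo q + lmo q * lmo p : V →L[ℝ] V) = lmo (p * q) + lmo (q * p) := by
  ext x
  have h := OctBimodule.assoc_alt p q x
  rw [neg_sub, sub_eq_sub_iff_add_eq_add, add_comm (OctBimodule.lm q _)] at h
  exact h.symm

lemma rmo_mul_add_rmo_mul (p q : Oct) :
    (rmo q * rmo p + rmo p * rmo q : V →L[ℝ] V) = rmo (p * q) + rmo (q * p) := by
  linear_combination (norm := abel) -lmo_mul_add_rmo_mul (V := V) p q -
    lmo_mul_add_rmo_mul (V := V) q p - lmo_mul_add_lmo_mul (V := V) p q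

lemma lmo_mul_self (p : Oct) : (lmo p * lmo p : V →L[ℝ] V) = lmo (p * p) := by
  have h := lmo_mul_add_lmo_mul (V := V) p p
  rwa [← two_smul ℝ, ← two_smul ℝ, smul_right_inj two_ne_zero] at h

lemma rmo_mul_self (p : Oct) : (rmo p * rmo p : V →L[ℝ] V) = rmo (p * p) := by
  have h := rmo_mul_add_rmo_mul (V := V) p p
  rwa [← two_smul ℝ, ← two_smul ℝ, smul_right_inj two_ne_zero] at h

lemma rmo_mul_lmo_self (p : Oct) : (rmo p * lmo p : V →L[ℝ] V) = lmo p * rmo p := by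
  have h := lmo_mul_sub (V := V) p p
  rw [lmo_mul_self, sub_self] at h
  exact (sub_eq_zero.mp h.symm)

/-- A pair of anticommuting imaginary units with product `a`. -/
structure IsUnitPair (i j a : Oct) : Prop where
  left_sq : i * i = -1
  right_sq : j * j = -1
  mul_eq : i * j = a
  mul_swap : j * i = -a

namespace IsUnitPair

variable {i j a : Oct}

lemma rotate (h : IsUnitPair i j a) : IsUnitPair j a i := by
  have ha : a = -(j * i) := by rw [h.mul_swap, neg_neg]
  have h1 : j * a = i := by
    rw [ha, mul_neg, left_alternative, h.right_sq]; simp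
  have h2 : a * j = -i := by
    rw [← h.mul_eq, right_alternative, h.right_sq]; simp
  have h3 : i * a = -j := by rw [← h.mul_eq, left_alternative, h.left_sq]; simp
  refine ⟨h.right_sq, ?_, h1, h2⟩
  have h4 := right_alternative (j + a) i
  have h5 : i * (a * a) = -i := by rw [← right_alternative, h3, neg_mul, h1]
  simp only [mul_add, add_mul, h.mul_eq, h1, h2, h3, h5, h.right_sq, h.left_sq, neg_mul, mul_neg,
    mul_one] at h4
  linear_combination (norm := abel) h4

lemma swap (h : IsUnitPair i j a) : IsUnitPair j i (-a) :=
  ⟨h.right_sq, h.left_sq, h.mul_swap, by rw [h.mul_eq, neg_neg]⟩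

lemma lmo_anticomm (h : IsUnitPair i j a) :
    (lmo i * lmo j + lmo j * lmo i : V →L[ℝ] V) = 0 := by
  rw [lmo_mul_add_lmo_mul, h.mul_eq, h.mul_swap, lmo_neg, add_neg_cancel]

lemma rmo_anticomm (h : IsUnitPair i j a) :
    (rmo i * rmo j + rmo j * rmo i : V →L[ℝ] V) = 0 := by
  rw [rmo_mul_add_rmo_mul, h.mul_eq, h.mul_swap, rmo_neg, neg_add_cancel]

lemma lmo_sq (h : IsUnitPair i j a) : (lmo i * lmo i : V →L[ℝ] V) = -1 := by
  rw [lmo_mul_self, h.left_sq, lmo_neg, lmo_one]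

lemma rmo_sq (h : IsUnitPair i j a) : (rmo i * rmo i : V →L[ℝ] V) = -1 := by
  rw [rmo_mul_self, h.left_sq, rmo_neg, rmo_one]

lemma lmo_add_rmo (h : IsUnitPair i j a) :
    (lmo a + rmo a : V →L[ℝ] V) = lmo i * lmo j + rmo j * rmo i := by
  rw [← lmo_mul_add_rmo_mul, h.mul_eq]

lemma lmo_sub (h : IsUnitPair i j a) :
    (lmo a - lmo i * lmo j : V →L[ℝ] V) = rmo i * lmo j - lmo j * rmo i := by
  rw [← lmo_mul_sub, h.mul_eq]

/-- The middle Moufang identity `(i(jx))i = (ij)(xi)`. -/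
lemma rmo_mul_lmo_mul_lmo (h : IsUnitPair i j a) :
    (rmo i * lmo i * lmo j : V →L[ℝ] V) = lmo a * rmo i := by
  have ha := h.rotate.rotate
  have h1 := ha.swap.lmo_sub (V := V)
  rw [lmo_neg] at h1
  linear_combination (norm := noncomm_ring) -rmo i * h.lmo_add_rmo (V := V) - h1 -
    ha.lmo_add_rmo (V := V) - ha.lmo_anticomm (V := V) - rmo i * h.rmo_anticomm (V := V) +
    h.rmo_sq (V := V) * rmo j

/-- The middle Moufang identity `i((xj)i) = (ix)(ji)`. -/
lemma rmo_mul_lmo_mul_rmo (h : IsUnitPair i j a) :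
    (rmo i * lmo i * rmo j : V →L[ℝ] V) = -(rmo a * lmo i) := by
  have ha := h.rotate.rotate
  have h1 := h.swap.lmo_add_rmo (V := V)
  rw [lmo_neg, rmo_neg] at h1
  rw [rmo_mul_lmo_self]
  linear_combination (norm := noncomm_ring) -lmo i * h1 - ha.lmo_sub (V := V) -
    ha.lmo_anticomm (V := V) - lmo i * h.lmo_anticomm (V := V) + h.lmo_sq (V := V) * lmo j

lemma conj_mul_commutator (h : IsUnitPair i j a) :
    ((rmo i * lmo i + rmo j * lmo j) * (lmo a - rmo a) : V →L[ℝ] V) =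
      2 • (lmo a - lmo i * lmo j) := by
  have hj := h.rotate
  have hi := hj.rotate.swap
  have h1 := hi.rmo_mul_lmo_mul_lmo (V := V)
  have h2 := hi.rmo_mul_lmo_mul_rmo (V := V)
  have h3 := h.swap.lmo_sub (V := V)
  rw [lmo_neg] at h1 h3
  rw [rmo_neg] at h2
  linear_combination (norm := noncomm_ring) h1 - h2 + hj.rmo_mul_lmo_mul_lmo (V := V) -
    hj.rmo_mul_lmo_mul_rmo (V := V) - h.lmo_sub (V := V) + h3 + h.lmo_anticomm (V := V)

end IsUnitPair

/-- The three lines of the Fano plane through the point `a`. -/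
structure IsLineSystem (b p q u v w a : Oct) : Prop where
  pq : IsUnitPair p q u
  qb : IsUnitPair q b v
  bp : IsUnitPair b p w
  bu : IsUnitPair b u a
  pv : IsUnitPair p v a
  qw : IsUnitPair q w a

namespace IsLineSystem

variable {b p q u v w a : Oct}

lemma sum_lmo_mul (h : IsLineSystem b p q u v w a) :
    (lmo b * lmo u + lmo p * lmo v + lmo q * lmo w : V →L[ℝ] V) = lmo a + 2 • rmo a := by
  have h1 := h.qb.swap.lmo_sub (V := V)
  rw [lmo_neg] at h1
  linear_combination (norm := noncomm_ring) -lmo p * h1 + rmo b * h.pq.lmo_add_rmo (V := V) -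
    rmo q * h.bp.rmo_anticomm (V := V) - h.bp.lmo_anticomm (V := V) * lmo q -
    h.bu.rmo_anticomm (V := V) + h.qb.rmo_anticomm (V := V) * rmo p + h.bu.lmo_sub (V := V) -
    h.bp.lmo_sub (V := V) * lmo q - 2 • h.bu.lmo_add_rmo (V := V) -
    h.pq.lmo_add_rmo (V := V) * rmo b + h.qw.lmo_anticomm (V := V)

lemma conj_mul_commutator (h : IsLineSystem b p q u v w a) :
    ((rmo a * lmo a + rmo b * lmo b + rmo p * lmo p + rmo q * lmo q + rmo u * lmo u +
      rmo v * lmo v + rmo w * lmo w) * (lmo a - rmo a) : V →L[ℝ] V) = 5 • (lmo a - rmo a) := by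
  have ha := h.bu.rotate.rotate
  have h1 := rmo_mul_lmo_self (V := V) a
  linear_combination (norm := noncomm_ring) h.bu.conj_mul_commutator (V := V) +
    h.pv.conj_mul_commutator (V := V) + h.qw.conj_mul_commutator (V := V) -
    2 • h.sum_lmo_mul (V := V) + rmo a * ha.lmo_sq (V := V) -
    h1 * rmo a - lmo a * ha.rmo_sq (V := V)

end IsLineSystem

end OperatorIdentities

namespace Oct

open scoped Quaternion

lemma unitPair_one_two_three : IsUnitPair (e 1) (e 2) (e 3) := by
  rw [e_one, e_two, e_three]
  constructor <;> ext <;> simp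

lemma unitPair_one_four_five : IsUnitPair (e 1) (e 4) (e 5) := by
  rw [e_one, e_four, e_five]
  constructor <;> ext <;> simp

lemma unitPair_one_seven_six : IsUnitPair (e 1) (e 7) (e 6) := by
  rw [e_one, e_seven, e_six]
  constructor <;> ext <;> simp

lemma unitPair_two_four_six : IsUnitPair (e 2) (e 4) (e 6) := by
  rw [e_two, e_four, e_six]
  constructor <;> ext <;> simp

lemma unitPair_two_five_seven : IsUnitPair (e 2) (e 5) (e 7) := by
  rw [e_two, e_five, e_seven]
  constructor <;> ext <;> simp

lemma unitPair_three_four_seven : IsUnitPair (e 3) (e 4) (e 7) := by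
  rw [e_three, e_four, e_seven]
  constructor <;> ext <;> simp

lemma unitPair_three_six_five : IsUnitPair (e 3) (e 6) (e 5) := by
  rw [e_three, e_six, e_five]
  constructor <;> ext <;> simp

lemma lineSystem_one :
    IsLineSystem (e 2) (e 4) (e 7) (e 3) (e 5) (e 6) (e 1) :=
  ⟨unitPair_three_four_seven.rotate, unitPair_two_five_seven.rotate.rotate,
    unitPair_two_four_six, unitPair_one_two_three.rotate,
    unitPair_one_four_five.rotate, unitPair_one_seven_six.rotate⟩

lemma lineSystem_two :
    IsLineSystem (e 3) (e 4) (e 5) (e 1) (e 6) (e 7) (e 2) :=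
  ⟨unitPair_one_four_five.rotate, unitPair_three_six_five.rotate.rotate,
    unitPair_three_four_seven, unitPair_one_two_three.rotate.rotate,
    unitPair_two_four_six.rotate, unitPair_two_five_seven.rotate⟩

lemma lineSystem_three :
    IsLineSystem (e 1) (e 4) (e 6) (e 2) (e 7) (e 5) (e 3) :=
  ⟨unitPair_two_four_six.rotate, unitPair_one_seven_six.rotate.rotate,
    unitPair_one_four_five, unitPair_one_two_three,
    unitPair_three_four_seven.rotate, unitPair_three_six_five.rotate⟩

lemma lineSystem_four :
    IsLineSystem (e 5) (e 7) (e 6) (e 1) (e 3) (e 2) (e 4) :=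
  ⟨unitPair_one_seven_six.rotate, unitPair_three_six_five.rotate,
    unitPair_two_five_seven.rotate, unitPair_one_four_five.rotate.rotate,
    unitPair_three_four_seven.rotate.rotate, unitPair_two_four_six.rotate.rotate⟩

lemma lineSystem_five :
    IsLineSystem (e 1) (e 7) (e 3) (e 4) (e 2) (e 6) (e 5) :=
  ⟨unitPair_three_four_seven.rotate.rotate, unitPair_one_two_three.rotate.rotate,
    unitPair_one_seven_six, unitPair_one_four_five,
    unitPair_two_five_seven.rotate.rotate, unitPair_three_six_five⟩

lemma lineSystem_six :
    IsLineSystem (e 1) (e 2) (e 5) (e 7) (e 4) (e 3) (e 6) :=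
  ⟨unitPair_two_five_seven, unitPair_one_four_five.rotate.rotate,
    unitPair_one_two_three, unitPair_one_seven_six,
    unitPair_two_four_six, unitPair_three_six_five.rotate.rotate⟩

lemma lineSystem_seven :
    IsLineSystem (e 2) (e 3) (e 6) (e 5) (e 4) (e 1) (e 7) :=
  ⟨unitPair_three_six_five, unitPair_two_four_six.rotate.rotate,
    unitPair_one_two_three.rotate, unitPair_two_five_seven,
    unitPair_three_four_seven, unitPair_one_seven_six.rotate.rotate⟩

lemma re_smul_one_eq (r : Oct) :
    (5 / 12 : ℝ) • r - (1 / 12 : ℝ) • ∑ i : Fin 7, e i.succ * r * e i.succ = re r • (1 : Oct) := by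
  rw [show ∑ i : Fin 7, e i.succ * r * e i.succ = e 1 * r * e 1 + e 2 * r * e 2 + e 3 * r * e 3 +
    e 4 * r * e 4 + e 5 * r * e 5 + e 6 * r * e 6 + e 7 * r * e 7 from Fin.sum_univ_seven _]
  simp only [e_one, e_two, e_three, e_four, e_five, e_six, e_seven]
  ext <;> simp [re] <;> ring

end Oct

lemma sum_conj_mul_left {E : Type*} [AddCommGroup E] [Module ℝ E] (β : Oct →ₗ[ℝ] Oct →ₗ[ℝ] E)
    (p : Oct) :
    ∑ i : Fin 8, β (conj (e i) * p) (e i) = ∑ i : Fin 8, β (conj (e i)) (p * e i) := by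
  calc ∑ i : Fin 8, β (conj (e i) * p) (e i)
      = ∑ i : Fin 8, ∑ j : Fin 8, re (conj (e i) * p * e j) • β (conj (e j)) (e i) :=
        Finset.sum_congr rfl fun i _ => by
          conv_lhs => rw [← sum_re_mul_smul_conj (conj (e i) * p)]
          simp
    _ = ∑ j : Fin 8, ∑ i : Fin 8, re (conj (e i) * (p * e j)) • β (conj (e j)) (e i) := by
        rw [Finset.sum_comm]; simp only [re_mul_assoc]
    _ = ∑ j : Fin 8, β (conj (e j)) (p * e j) :=
        Finset.sum_congr rfl fun j _ => by
          conv_rhs => rw [← sum_re_conj_mul_smul (p * e j)]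
          simp

lemma sum_mul_conj_left {E : Type*} [AddCommGroup E] [Module ℝ E] (β : Oct →ₗ[ℝ] Oct →ₗ[ℝ] E)
    (p : Oct) :
    ∑ i : Fin 8, β (p * conj (e i)) (e i) = ∑ i : Fin 8, β (conj (e i)) (e i * p) := by
  calc ∑ i : Fin 8, β (p * conj (e i)) (e i)
      = ∑ i : Fin 8, ∑ j : Fin 8, re (p * conj (e i) * e j) • β (conj (e j)) (e i) :=
        Finset.sum_congr rfl fun i _ => by
          conv_lhs => rw [← sum_re_mul_smul_conj (p * conj (e i))]
          simp
    _ = ∑ j : Fin 8, ∑ i : Fin 8, re (conj (e i) * (e j * p)) • β (conj (e j)) (e i) := by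
        rw [Finset.sum_comm]
        simp only [re_mul_assoc, re_mul_comm p]
    _ = ∑ j : Fin 8, β (conj (e j)) (e j * p) :=
        Finset.sum_congr rfl fun j _ => by
          conv_rhs => rw [← sum_re_conj_mul_smul (e j * p)]
          simp

section RealPart

variable {V : Type*} [NormedAddCommGroup V] [NormedSpace ℝ V] [OctBimodule V]

lemma sum_rmo_mul_lmo :
    ∑ i : Fin 7, (rmo (e i.succ)).comp (lmo (e i.succ)) =
      (rmo (e 1) * lmo (e 1) + rmo (e 2) * lmo (e 2) + rmo (e 3) * lmo (e 3) +
        rmo (e 4) * lmo (e 4) + rmo (e 5) * lmo (e 5) + rmo (e 6) * lmo (e 6) +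
        rmo (e 7) * lmo (e 7) : V →L[ℝ] V) :=
  Fin.sum_univ_seven _

lemma reO_mul_commutator_of_conj {a : Oct}
    (h : ((rmo (e 1) * lmo (e 1) + rmo (e 2) * lmo (e 2) + rmo (e 3) * lmo (e 3) +
        rmo (e 4) * lmo (e 4) + rmo (e 5) * lmo (e 5) + rmo (e 6) * lmo (e 6) +
        rmo (e 7) * lmo (e 7)) * (lmo a - rmo a) : V →L[ℝ] V) = 5 • (lmo a - rmo a)) :
    reO V * (lmo a - rmo a) = 0 := by
  rw [reO, sum_rmo_mul_lmo, sub_mul, smul_mul_assoc, smul_mul_assoc, h]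
  change (5 / 12 : ℝ) • (1 * (lmo a - rmo a)) - _ = _
  rw [one_mul]
  module

lemma reO_mul_lmo_basis (k : Fin 8) : reO V * lmo (e k) = reO V * rmo (e k) := by
  rw [← sub_eq_zero, ← mul_sub]
  fin_cases k
  · change reO V * (lmo (1 : Oct) - rmo (1 : Oct)) = 0
    rw [lmo_one, rmo_one, sub_self, mul_zero]
  · refine reO_mul_commutator_of_conj (Eq.trans ?_ lineSystem_one.conj_mul_commutator)
    congr 1; abel
  · refine reO_mul_commutator_of_conj (Eq.trans ?_ lineSystem_two.conj_mul_commutator)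
    congr 1; abel
  · refine reO_mul_commutator_of_conj (Eq.trans ?_ lineSystem_three.conj_mul_commutator)
    congr 1; abel
  · refine reO_mul_commutator_of_conj (Eq.trans ?_ lineSystem_four.conj_mul_commutator)
    congr 1; abel
  · refine reO_mul_commutator_of_conj (Eq.trans ?_ lineSystem_five.conj_mul_commutator)
    congr 1; abel
  · refine reO_mul_commutator_of_conj (Eq.trans ?_ lineSystem_six.conj_mul_commutator)
    congr 1; abel
  · refine reO_mul_commutator_of_conj (Eq.trans ?_ lineSystem_seven.conj_mul_commutator)
    congr 1; abel

/-- The real part of a bimodule annihilates commutators. -/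
lemma reO_mul_lmo (p : Oct) : reO V * lmo p = reO V * rmo p := by
  rw [← sum_re_conj_mul_smul p]
  simp only [lmo, rmo, map_sum, map_smul, Finset.mul_sum, mul_smul_comm]
  exact Finset.sum_congr rfl fun k _ => congrArg _ (reO_mul_lmo_basis k)

lemma reO_mul_rmo_mul_lmo (p q : Oct) : reO V * (rmo p * lmo q) = reO V * rmo (p * q) := by
  have hl : reO V * (lmo p * lmo q) = reO V * (rmo p * lmo q) := by
    rw [← mul_assoc, reO_mul_lmo, mul_assoc]
  have hr : reO V * (lmo q * rmo p) = reO V * (rmo q * rmo p) := by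
    rw [← mul_assoc, reO_mul_lmo, mul_assoc]
  have h1 := congrArg (reO V * ·) (lmo_mul_add_rmo_mul (V := V) p q)
  have h2 := congrArg (reO V * ·) (lmo_mul_sub (V := V) p q)
  simp only [mul_add, mul_sub, hl, hr, reO_mul_lmo] at h1 h2
  refine smul_right_injective _ (three_ne_zero : (3 : ℝ) ≠ 0) ?_
  linear_combination (norm := module) -h1 - h2

/-- The real part of a bimodule annihilates associators. -/
lemma reO_mul_rmo_mul_rmo (p q : Oct) : reO V * (rmo q * rmo p) = reO V * rmo (p * q) := by
  have h := congrArg (reO V * ·) (lmo_mul_add_rmo_mul (V := V) p q)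
  simp only [mul_add, reO_mul_lmo] at h
  rw [← mul_assoc (reO V) (lmo p), reO_mul_lmo, mul_assoc, reO_mul_rmo_mul_lmo] at h
  exact (add_left_cancel h).symm

/-- The bilinear map `(q, r) ↦ G(Re(xq)) r`. -/
def extForm (G : V →L[ℝ] V) (x : V) : Oct →ₗ[ℝ] Oct →ₗ[ℝ] V :=
  LinearMap.mk₂ ℝ (fun q r => rmo r (G (reO V (rmo q x))))
    (fun _ _ _ => by simp [rmo_add]) (fun _ _ _ => by simp [rmo_smul])
    (fun _ _ _ => by simp [rmo_add]) (fun _ _ _ => by simp [rmo_smul])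

lemma extO_apply (G : V →L[ℝ] V) (x : V) :
    extO G x = ∑ i : Fin 8, extForm G x (conj (e i)) (e i) := by
  simp [extO, extForm, sum_apply]

lemma extForm_lmo (G : V →L[ℝ] V) (x : V) (p q r : Oct) :
    extForm G (lmo p x) q r = extForm G x (q * p) r :=
  congrArg (fun y => rmo r (G y)) (DFunLike.congr_fun (reO_mul_rmo_mul_lmo q p) x)

lemma extForm_rmo (G : V →L[ℝ] V) (x : V) (p q r : Oct) :
    extForm G (rmo p x) q r = extForm G x (p * q) r :=
  congrArg (fun y => rmo r (G y)) (DFunLike.congr_fun (reO_mul_rmo_mul_rmo p q) x)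

lemma extForm_rmo_mul (G : V →L[ℝ] V) (x : V) (p q r : Oct) :
    extForm (rmo p * G) x q r + rmo p (extForm G x q r) =
      extForm G x q (p * r) + extForm G x q (r * p) := by
  rw [← map_add]
  simpa [extForm, rmo_add] using
    DFunLike.congr_fun (rmo_mul_add_rmo_mul (V := V) p r) (G (reO V (rmo q x)))

/-- Right multiplication of an extended operator: `ext G ⊙ p = ext (x ↦ G(x) p)`. -/
lemma odotR_extO (G : V →L[ℝ] V) (p : Oct) : odotR (extO G) p = extO (rmo p * G) := by
  ext x
  change extO G (lmo p x) - (rmo p (extO G x) - extO G (rmo p x)) = extO (rmo p * G) x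
  simp only [extO_apply, extForm_lmo, extForm_rmo, sum_conj_mul_left, sum_mul_conj_left, map_sum]
  rw [← sub_add, sub_add_eq_add_sub, sub_eq_iff_eq_add, ← Finset.sum_add_distrib,
    ← Finset.sum_add_distrib]
  exact Finset.sum_congr rfl fun i _ => (extForm_rmo_mul G x p _ _).symm

lemma rmo_lmo_of_mem_ReSet {v : V} (hv : v ∈ ReSet V) (p q : Oct) :
    rmo q (lmo p v) = lmo (p * q) v := by
  have h := OctBimodule.assoc_cyc₁ q p v
  change lmo (q * p) v - lmo q (lmo p v) = rmo q (lmo p v) - lmo p (rmo q v) at h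
  rwa [hv.1, sub_self, eq_comm, sub_eq_zero, ← hv.2, ← hv.1] at h

lemma reO_rmo_of_mem_ReSet {v : V} (hv : v ∈ ReSet V) (r : Oct) :
    reO V (rmo r v) = re r • v := by
  have h : (5 / 12 : ℝ) • lmo r v - (1 / 12 : ℝ) • ∑ i : Fin 7, lmo (e i.succ * r * e i.succ) v =
      re r • v := by
    simpa [lmo, sub_apply, smul_apply, sum_apply, OctBimodule.lm_one] using
      DFunLike.congr_fun (congrArg (lmo (V := V)) (re_smul_one_eq r)) v
  rw [← h, ← hv.2]
  simp [reO, sub_apply, smul_apply, sum_apply, rmo_lmo_of_mem_ReSet hv, ← hv.1]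

/-- An extended operator agrees with the original one on the real part. -/
lemma extO_apply_of_mem_ReSet (G : V →L[ℝ] V) {v : V} (hv : v ∈ ReSet V) :
    extO G v = G v := by
  have h (i : Fin 8) : extForm G v (conj (e i)) (e i) = re (conj (e i) * 1) • rmo (e i) (G v) := by
    simp [extForm, reO_rmo_of_mem_ReSet hv]
  have h1 := congrArg (fun p : Oct => rmo p (G v)) (sum_re_conj_mul_smul 1)
  simp only [rmo_one] at h1
  rw [extO_apply, Finset.sum_congr rfl fun i _ => h i]
  simpa [rmo, sum_apply] using h1

end RealPart

namespace Oct

open scoped Quaternion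

lemma mul_e_zero (p : Oct) : p * e 0 = p := mul_one p

lemma re_eq_zero_of_mem_unitSphere {J : Oct} (hJ : J ∈ unitSphere) : re J = 0 := by
  have h : J * J = -1 := hJ
  simp only [Oct.ext_iff, Quaternion.ext_iff] at h
  simp at h
  obtain ⟨⟨h0, h1, h2, h3⟩, h4, h5, h6, h7⟩ := h
  by_contra hr
  have hr : J.a.re ≠ 0 := hr
  have hI : J.a.imI = 0 := mul_left_cancel₀ hr (by linarith)
  have hJ : J.a.imJ = 0 := mul_left_cancel₀ hr (by linarith)
  have hK : J.a.imK = 0 := mul_left_cancel₀ hr (by linarith)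
  have hb : J.b.re = 0 := h4.resolve_right hr
  have hbI : J.b.imI = 0 := mul_left_cancel₀ hr (by linarith)
  have hbJ : J.b.imJ = 0 := mul_left_cancel₀ hr (by linarith)
  have hbK : J.b.imK = 0 := mul_left_cancel₀ hr (by linarith)
  rw [hI, hJ, hK, hb, hbI, hbJ, hbK] at h0
  nlinarith [sq_nonneg J.a.re]

lemma re_toSlice {J : Oct} (hJ : J ∈ unitSphere) (z : ℂ) : re (toSlice J z) = z.re := by
  have h : J.a.re = 0 := re_eq_zero_of_mem_unitSphere hJ
  simp [toSlice, re, h]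

lemma toSlice_I (J : Oct) : toSlice J Complex.I = J := by simp [toSlice]

lemma toSlice_add (J : Oct) (z w : ℂ) : toSlice J (z + w) = toSlice J z + toSlice J w := by
  simp only [toSlice, Complex.add_re, Complex.add_im]
  module

lemma toSlice_ofReal_mul (J : Oct) (r : ℝ) (z : ℂ) : toSlice J (r * z) = r • toSlice J z := by
  simp only [toSlice, Complex.re_ofReal_mul, Complex.im_ofReal_mul]
  module

lemma continuous_toSlice (J : Oct) : Continuous (toSlice J) := by
  unfold toSlice
  fun_prop

lemma toSlice_mul_toSlice_mul {J : Oct} (hJ : J ∈ unitSphere) (z w : ℂ) (y : Oct) :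
    toSlice J z * (toSlice J w * y) = toSlice J (z * w) * y := by
  have h : J * (J * y) = -y := by
    rw [left_alternative, show J * J = -1 from hJ, neg_one_mul]
  simp only [toSlice, add_mul, mul_add, smul_mul_assoc, mul_smul_comm, one_mul, h,
    Complex.mul_re, Complex.mul_im]
  module

lemma toSlice_mul {J : Oct} (hJ : J ∈ unitSphere) (z w : ℂ) :
    toSlice J z * toSlice J w = toSlice J (z * w) := by
  simpa using toSlice_mul_toSlice_mul hJ z w 1

lemma neg_toSlice_mul_self {J : Oct} (hJ : J ∈ unitSphere) (z : ℂ) :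
    -(toSlice J z) * J = toSlice J (-(z * Complex.I)) := by
  have h := toSlice_mul hJ z Complex.I
  rw [toSlice_I] at h
  rw [neg_mul, h]
  simp only [toSlice, Complex.neg_re, Complex.neg_im]
  module

lemma mem_of_toSlice_mem_OmegaD {J : Oct} (hJ : J ∈ unitSphere) {D : Set ℂ}
    (hD : ∀ z ∈ D, (starRingEnd ℂ) z ∈ D) {z : ℂ} (hz : toSlice J z ∈ OmegaD D) : z ∈ D := by
  simp only [OmegaD, Set.mem_iUnion, Set.mem_image] at hz
  obtain ⟨J', hJ', d, hd, h⟩ := hz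
  have hre : d.re = z.re := by rw [← re_toSlice hJ' d, h, re_toSlice hJ]
  have hre2 : (d * d).re = (z * z).re := by
    rw [← re_toSlice hJ' (d * d), ← toSlice_mul hJ', h, toSlice_mul hJ, re_toSlice hJ]
  simp only [Complex.mul_re, hre] at hre2
  rcases mul_self_eq_mul_self_iff.1 (sub_right_injective hre2) with him | him
  · rwa [← Complex.ext hre him]
  · rw [show z = (starRingEnd ℂ) d from Complex.ext hre.symm (by simp [him])]
    exact hD d hd

end Oct

section RightProduct

variable {V : Type*} [NormedAddCommGroup V] [NormedSpace ℝ V] [OctBimodule V]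

lemma rmo_toSlice_mul_rmo_toSlice {J : Oct} (hJ : J ∈ unitSphere) (z w : ℂ) :
    rmo (toSlice J w) * rmo (toSlice J z) = (rmo (toSlice J (z * w)) : V →L[ℝ] V) := by
  have h : rmo J * rmo J = (-1 : V →L[ℝ] V) := by
    rw [rmo_mul_self, show J * J = -1 from hJ, rmo_neg, rmo_one]
  simp only [toSlice, rmo_add, rmo_smul, rmo_one, add_mul, mul_add, smul_mul_assoc,
    mul_smul_comm, one_mul, mul_one, h, Complex.mul_re, Complex.mul_im]
  module

lemma odotR_e_zero (T : V →L[ℝ] V) : odotR T (e 0) = T := by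
  change T * lmo 1 - (rmo 1 * T - T * rmo 1) = T
  simp [lmo_one, rmo_one]

/-- The operator `T ⊙ p`, as a linear map in `p`. -/
def odotRLinearMap (T : V →L[ℝ] V) : Oct →ₗ[ℝ] V →L[ℝ] V where
  toFun := odotR T
  map_add' p q := by
    change T * lmo (p + q) - (rmo (p + q) * T - T * rmo (p + q)) =
      T * lmo p - (rmo p * T - T * rmo p) + (T * lmo q - (rmo q * T - T * rmo q))
    rw [lmo_add, rmo_add]
    noncomm_ring
  map_smul' r p := by
    change T * lmo (r • p) - (rmo (r • p) * T - T * rmo (r • p)) =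
      r • (T * lmo p - (rmo p * T - T * rmo p))
    simp only [lmo_smul, rmo_smul, mul_smul_comm, smul_mul_assoc, smul_sub]

/-- The operator `T ⊙ p`, as a continuous linear map in `T`. -/
def odotRCLM (p : Oct) : (V →L[ℝ] V) →L[ℝ] (V →L[ℝ] V) :=
  (ContinuousLinearMap.mul ℝ (V →L[ℝ] V)).flip (lmo p + rmo p) -
    ContinuousLinearMap.mul ℝ (V →L[ℝ] V) (rmo p)

lemma odotRCLM_apply (T : V →L[ℝ] V) (p : Oct) : odotRCLM p T = odotR T p := by
  change T * (lmo p + rmo p) - rmo p * T = T * lmo p - (rmo p * T - T * rmo p)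
  noncomm_ring

lemma continuous_lmo : Continuous (lmo : Oct → V →L[ℝ] V) :=
  (OctBimodule.lm (V := V)).continuous_of_finiteDimensional

lemma continuous_rmo : Continuous (rmo : Oct → V →L[ℝ] V) :=
  (OctBimodule.rm (V := V)).continuous_of_finiteDimensional

lemma continuous_odotR : Continuous fun x : (V →L[ℝ] V) × Oct => odotR x.1 x.2 := by
  have hl : Continuous fun x : (V →L[ℝ] V) × Oct => (lmo x.2 : V →L[ℝ] V) :=
    continuous_lmo.comp continuous_snd
  have hr : Continuous fun x : (V →L[ℝ] V) × Oct => (rmo x.2 : V →L[ℝ] V) :=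
    continuous_rmo.comp continuous_snd
  unfold odotR Bop
  exact (continuous_fst.clm_comp hl).sub
    ((hr.clm_comp continuous_fst).sub (continuous_fst.clm_comp hr))

lemma continuous_extO : Continuous (extO : (V →L[ℝ] V) → V →L[ℝ] V) := by
  unfold extO
  exact continuous_finsetSum _ fun i _ =>
    continuous_const.clm_comp (continuous_id.clm_comp continuous_const)

lemma continuous_octMul_const (q : Oct) : Continuous fun p : Oct => p * q :=
  (LinearMap.mulRight ℝ q).continuous_of_finiteDimensional

lemma odotR_odotR_extO_toSlice {J : Oct} (hJ : J ∈ unitSphere) (G : V →L[ℝ] V) (z w : ℂ) :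
    odotR (odotR (extO G) (toSlice J z)) (toSlice J w) = odotR (extO G) (toSlice J (z * w)) := by
  rw [odotR_extO, odotR_extO, odotR_extO, ← mul_assoc, rmo_toSlice_mul_rmo_toSlice hJ]

lemma odotR_extO_apply_of_mem_ReSet (G : V →L[ℝ] V) (p : Oct) {v : V} (hv : v ∈ ReSet V) :
    odotR (extO G) p v = rmo p (G v) := by
  rw [odotR_extO, extO_apply_of_mem_ReSet _ hv]
  rfl

/-- The slice product of a combination of the components of `J` collapses to the slice. -/
lemma sum_odotR_stemFamily {J : Oct} (hJ : J ∈ unitSphere) {c : Fin 8 → ℝ}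
    (hc : J = ∑ i : Fin 8, c i • e i) (hc0 : c 0 = 0) (F₀ F₁ : ℂ → ℂ) (G : V →L[ℝ] V)
    (z w : ℂ) :
    ∑ i : Fin 8, odotR (odotR (extO G) (toSlice J w * toSlice J (stemFamily c F₀ F₁ i z))) (e i) =
      odotR (extO G) (toSlice J w * toSlice J (F₀ z + F₁ z * Complex.I)) := by
  have h (i : Fin 7) :
      odotR (odotR (extO G) (toSlice J w * toSlice J (stemFamily c F₀ F₁ i.succ z))) (e i.succ) =
        odotRLinearMap (odotR (extO G) (toSlice J (w * F₁ z))) (c i.succ • e i.succ) := by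
    rw [stemFamily, if_neg i.succ_ne_zero, toSlice_ofReal_mul, mul_smul_comm, toSlice_mul hJ,
      map_smul]
    change odotR (odotRLinearMap (extO G) (_ • _)) _ = _
    rw [map_smul, ← odotRCLM_apply, map_smul, odotRCLM_apply]
    rfl
  have hI := odotR_odotR_extO_toSlice hJ G (w * F₁ z) Complex.I
  rw [toSlice_I] at hI
  have hJ' : J = ∑ i : Fin 7, c i.succ • e i.succ := by
    rw [hc, Fin.sum_univ_succ, hc0, zero_smul, zero_add]
  rw [Fin.sum_univ_succ, Finset.sum_congr rfl fun i _ => h i, ← map_sum, ← hJ', stemFamily,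
    if_pos rfl, odotR_e_zero, toSlice_mul hJ, toSlice_mul hJ, mul_add,
    toSlice_add, ← mul_assoc]
  exact (congrArg _ hI).trans (map_add (odotRLinearMap (extO G)) _ _).symm

lemma isUnit_of_notMem_pbSpec {T : V →L[ℝ] V} {s : Oct} (hs : s ∉ pbSpec T) :
    IsUnit (rmo s - T) := by
  simp only [pbSpec, Set.mem_sdiff, Set.mem_univ, true_and, not_not, pbRes, Set.mem_iUnion] at hs
  obtain ⟨_, _, h⟩ := hs
  exact h.2.1

end RightProduct

section ContourIntegral

variable {J : Oct} {U : Set Oct} (Γ : SliceContour J U) {E F : Type*}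
  [NormedAddCommGroup E] [NormedAddCommGroup F]

/-- Integrability of `Φ(s, ds)` along each curve of a slice contour. -/
def ContourIntegrable (Φ : ℂ → ℂ → E) : Prop :=
  ∀ i, IntervalIntegrable (fun t => Φ (Γ.γ i t) (deriv (Γ.γ i) t)) MeasureTheory.volume 0 1

variable {Γ}

lemma ContourIntegrable.sum {ι : Type*} (s : Finset ι) {Φ : ι → ℂ → ℂ → E}
    (hΦ : ∀ k ∈ s, ContourIntegrable Γ (Φ k)) :
    ContourIntegrable Γ fun z dz => ∑ k ∈ s, Φ k z dz := fun i => by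
  simpa only [Finset.sum_fn] using IntervalIntegrable.sum s fun k hk => hΦ k hk i

variable [NormedSpace ℝ E] [NormedSpace ℝ F]

lemma ContourIntegrable.clm_apply (L : E →L[ℝ] F) {Φ : ℂ → ℂ → E} (hΦ : ContourIntegrable Γ Φ) :
    ContourIntegrable Γ fun z dz => L (Φ z dz) :=
  fun i => ⟨L.integrable_comp (hΦ i).1, L.integrable_comp (hΦ i).2⟩

lemma contourSum_sub {Φ Ψ : ℂ → ℂ → E} (hΦ : ContourIntegrable Γ Φ)
    (hΨ : ContourIntegrable Γ Ψ) :
    contourSum Γ (fun z dz => Φ z dz - Ψ z dz) = contourSum Γ Φ - contourSum Γ Ψ := by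
  simp only [contourSum, ← Finset.sum_sub_distrib]
  exact Finset.sum_congr rfl fun i _ => intervalIntegral.integral_sub (hΦ i) (hΨ i)

lemma contourSum_sum {ι : Type*} (s : Finset ι) {Φ : ι → ℂ → ℂ → E}
    (hΦ : ∀ k ∈ s, ContourIntegrable Γ (Φ k)) :
    contourSum Γ (fun z dz => ∑ k ∈ s, Φ k z dz) = ∑ k ∈ s, contourSum Γ (Φ k) := by
  simp only [contourSum]
  rw [Finset.sum_comm]
  exact Finset.sum_congr rfl fun i _ =>
    intervalIntegral.integral_finsetSum fun k hk => hΦ k hk i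

lemma clm_contourSum [CompleteSpace E] [CompleteSpace F] (L : E →L[ℝ] F) {Φ : ℂ → ℂ → E}
    (hΦ : ContourIntegrable Γ Φ) :
    L (contourSum Γ Φ) = contourSum Γ fun z dz => L (Φ z dz) := by
  simp only [contourSum, map_sum]
  exact Finset.sum_congr rfl fun i _ => (L.intervalIntegral_comp_comm (hΦ i)).symm

lemma SliceContour.mem_frontier (Γ : SliceContour J U) (i : Fin Γ.n) {t : ℝ}
    (ht : t ∈ Set.Icc (0 : ℝ) 1) : Γ.γ i t ∈ frontier (toSlice J ⁻¹' U) := by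
  rw [← Γ.image_eq]
  exact Set.mem_iUnion_of_mem i (Set.mem_image_of_mem _ ht)

lemma SliceContour.toSlice_mem_closure (Γ : SliceContour J U) (i : Fin Γ.n) {t : ℝ}
    (ht : t ∈ Set.Icc (0 : ℝ) 1) : toSlice J (Γ.γ i t) ∈ closure U :=
  (continuous_toSlice J).closure_preimage_subset U (frontier_subset_closure (Γ.mem_frontier i ht))

lemma SliceContour.toSlice_notMem (Γ : SliceContour J U) (hU : IsOpen U) (i : Fin Γ.n) {t : ℝ}
    (ht : t ∈ Set.Icc (0 : ℝ) 1) : toSlice J (Γ.γ i t) ∉ U := by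
  have h := Γ.mem_frontier i ht
  rw [(hU.preimage (continuous_toSlice J)).frontier_eq] at h
  exact h.2

variable {V : Type*} [NormedAddCommGroup V] [NormedSpace ℝ V] [CompleteSpace V] [OctBimodule V]

lemma continuousOn_rinvR {T : V →L[ℝ] V} (hU : LeftAdmissible T U) (i : Fin Γ.n) :
    ContinuousOn (fun t => rinvR (rmo (toSlice J (Γ.γ i t)) - T)) (Set.Icc (0 : ℝ) 1) := by
  refine continuous_extO.comp_continuousOn fun t ht => ?_
  obtain ⟨u, hu⟩ := isUnit_of_notMem_pbSpec
    fun h => Γ.toSlice_notMem hU.1.isOpen i ht (hU.2 h)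
  have h := NormedRing.inverse_continuousAt u
  rw [hu] at h
  exact h.comp_continuousWithinAt (f := fun t => rmo (toSlice J (Γ.γ i t)) - T)
    (((continuous_rmo.comp ((continuous_toSlice J).comp
      (Γ.smooth i).continuous)).sub continuous_const).continuousWithinAt)

lemma continuousOn_differential_mul (hJ : J ∈ unitSphere) {D : Set ℂ} {f : ℂ → ℂ}
    (hf : IsStem D f) (hUD : closure U ⊆ OmegaD D) (i : Fin Γ.n) :
    ContinuousOn (fun t => -(toSlice J (deriv (Γ.γ i) t)) * J * toSlice J (f (Γ.γ i t)))
      (Set.Icc (0 : ℝ) 1) := by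
  simp only [neg_toSlice_mul_self hJ, toSlice_mul hJ]
  have hγ : ContinuousOn (fun t => f (Γ.γ i t)) (Set.Icc (0 : ℝ) 1) :=
    hf.holo.continuousOn.comp (Γ.smooth i).continuous.continuousOn fun t ht =>
      mem_of_toSlice_mem_OmegaD hJ hf.conj_mem (hUD (Γ.toSlice_mem_closure i ht))
  have hd : Continuous (deriv (Γ.γ i)) := (Γ.smooth i).continuous_deriv le_rfl
  exact (continuous_toSlice J).comp_continuousOn
    ((hd.mul continuous_const).neg.continuousOn.mul hγ)

lemma contourIntegrable_odotR_rinvR {T : V →L[ℝ] V} (hU : LeftAdmissible T U)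
    (hJ : J ∈ unitSphere) {D : Set ℂ} {f : ℂ → ℂ} (hf : IsStem D f)
    (hUD : closure U ⊆ OmegaD D) (q : Oct) :
    ContourIntegrable Γ fun z dz =>
      odotR (rinvR (rmo (toSlice J z) - T)) (-(toSlice J dz) * J * toSlice J (f z) * q) :=
  fun i => (continuous_odotR.comp_continuousOn ((continuousOn_rinvR hU i).prodMk
    ((continuous_octMul_const q).comp_continuousOn
      (continuousOn_differential_mul hJ hf hUD i)))).intervalIntegrable_of_Icc zero_le_one

/-- Right multiplication commutes with the slice functional calculus integral. -/
lemma odotR_leftFC {T : V →L[ℝ] V} (hU : LeftAdmissible T U) (hJ : J ∈ unitSphere)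
    {D : Set ℂ} {f : ℂ → ℂ} (hf : IsStem D f) (hUD : closure U ⊆ OmegaD D) (q : Oct) :
    odotR (leftFC T J Γ f) q = (2 * Real.pi)⁻¹ • contourSum Γ fun z dz =>
      odotR (odotR (rinvR (rmo (toSlice J z) - T)) (-(toSlice J dz) * J * toSlice J (f z))) q := by
  have h := contourIntegrable_odotR_rinvR (Γ := Γ) hU hJ hf hUD 1
  simp only [mul_one] at h
  rw [← odotRCLM_apply, leftFC, map_smul, clm_contourSum _ h]
  simp only [odotRCLM_apply]

lemma contourIntegrable_odotR_odotR_rinvR {T : V →L[ℝ] V} (hU : LeftAdmissible T U)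
    (hJ : J ∈ unitSphere) {D : Set ℂ} {f : ℂ → ℂ} (hf : IsStem D f)
    (hUD : closure U ⊆ OmegaD D) (q : Oct) :
    ContourIntegrable Γ fun z dz =>
      odotR (odotR (rinvR (rmo (toSlice J z) - T)) (-(toSlice J dz) * J * toSlice J (f z))) q := by
  have h := (contourIntegrable_odotR_rinvR (Γ := Γ) hU hJ hf hUD 1).clm_apply (odotRCLM q)
  simpa only [mul_one, odotRCLM_apply] using h

end ContourIntegral

lemma odotR_differential_mul_sum {V : Type*} [NormedAddCommGroup V] [NormedSpace ℝ V]
    [OctBimodule V] {J : Oct} (hJ : J ∈ unitSphere) (A : V →L[ℝ] V) (z dz : ℂ)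
    (f : Fin 8 → ℂ → ℂ) :
    odotR A (-(toSlice J dz) * J * ∑ i : Fin 8, toSlice J (f i z) * e i) =
      ∑ i : Fin 8, odotR A (-(toSlice J dz) * J * toSlice J (f i z) * e i) := by
  simp only [neg_toSlice_mul_self hJ, Finset.mul_sum, toSlice_mul_toSlice_mul hJ, toSlice_mul hJ]
  exact map_sum (odotRLinearMap A) _ _

end OctonionRing

/-- For a power-associative bounded right para-linear operator `T`, a
`T`-left-admissible domain `U` and a left slice regular `f = ∑_{i=0}^{7} f_{(i)} •^L e_i`
(each `f_{(i)}` slice preserving, with stem `Fc i`), the functional calculus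
`f*(T)_J = ∑_i (f_{(i)}*(T)_J) ⊙ e_i` satisfies, for every `J ∈ 𝕊`,
`f*(T)_J = (1/2π)∫(R_s−T)^{⊚−} ⊙ (ds_J f(s)) + (1/2π)∑_{i=1}^{7}∫[(R_s−T)^{⊚−}, ds_J f_{(i)}(s), e_i]`.
In particular, if `f = f₀ + f₁ •^L J`, then `f*(T)_J = (1/2π)∫(R_s−T)^{⊚−} ⊙ (ds_J f(s))`
and, for `v ∈ Re V`, `f*(T)_J(v) = (1/2π)∫ (R_s−T)^{−1}(v) (ds_J f(s))`. -/
theorem statement_16 {V : Type*} [NormedAddCommGroup V] [NormedSpace ℝ V] [CompleteSpace V]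
    [OctBimodule V] (T : V →L[ℝ] V) (hT : IsRightPara T) (hpa : IsPowerAssoc T)
    (U : Set Oct) (hU : LeftAdmissible T U)
    (D : Set ℂ) (Fc : Fin 8 → ℂ → ℂ) (hFc : ∀ i, IsStem D (Fc i))
    (hUD : closure U ⊆ OmegaD D)
    (J : Oct) (hJ : J ∈ unitSphere) (Γ : SliceContour J U) :
    (∑ i : Fin 8, odotR (leftFC T J Γ (Fc i)) (e i) =
      (2 * Real.pi)⁻¹ • contourSum Γ (fun z dz =>
        odotR (rinvR ((rmo (Oct.toSlice J z) : V →L[ℝ] V) - T))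
          ((-(Oct.toSlice J dz) * J) * ∑ i : Fin 8, Oct.toSlice J (Fc i z) * e i)) +
      (2 * Real.pi)⁻¹ • ∑ i : Fin 7, contourSum Γ (fun z dz =>
        odotR (odotR (rinvR ((rmo (Oct.toSlice J z) : V →L[ℝ] V) - T))
            ((-(Oct.toSlice J dz) * J) * Oct.toSlice J (Fc i.succ z))) (e i.succ) -
        odotR (rinvR ((rmo (Oct.toSlice J z) : V →L[ℝ] V) - T))
          (((-(Oct.toSlice J dz) * J) * Oct.toSlice J (Fc i.succ z)) * e i.succ))) ∧
    (∀ (c : Fin 8 → ℝ) (F₀ F₁ : ℂ → ℂ), J = ∑ i : Fin 8, c i • e i → c 0 = 0 →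
      Fc = stemFamily c F₀ F₁ →
      (∑ i : Fin 8, odotR (leftFC T J Γ (Fc i)) (e i) =
        leftFC T J Γ fun z => F₀ z + F₁ z * Complex.I) ∧
      ∀ v ∈ ReSet V,
        (∑ i : Fin 8, odotR (leftFC T J Γ (Fc i)) (e i)) v =
          (2 * Real.pi)⁻¹ • contourSum Γ (fun z dz =>
            rmo ((-(Oct.toSlice J dz) * J) * Oct.toSlice J (F₀ z + F₁ z * Complex.I))
              (Ring.inverse ((rmo (Oct.toSlice J z) : V →L[ℝ] V) - T) v))) := by
  have hΦ (i : Fin 8) := contourIntegrable_odotR_odotR_rinvR (Γ := Γ) hU hJ (hFc i) hUD (e i)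
  have hΨ (i : Fin 8) := contourIntegrable_odotR_rinvR (Γ := Γ) hU hJ (hFc i) hUD (e i)
  have hsum : ∑ i : Fin 8, odotR (leftFC T J Γ (Fc i)) (e i) =
      (2 * Real.pi)⁻¹ • contourSum Γ fun z dz => ∑ i : Fin 8,
        odotR (odotR (rinvR (rmo (toSlice J z) - T))
          (-(toSlice J dz) * J * toSlice J (Fc i z))) (e i) := by
    rw [contourSum_sum _ fun i _ => hΦ i, Finset.smul_sum]
    exact Finset.sum_congr rfl fun i _ => odotR_leftFC hU hJ (hFc i) hUD (e i)
  refine ⟨?_, fun c F₀ F₁ hc hc0 hstem => ?_⟩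
  · simp only [odotR_differential_mul_sum hJ]
    rw [hsum, contourSum_sum _ fun i _ => hΦ i, contourSum_sum _ fun i _ => hΨ i,
      Finset.sum_congr rfl fun i _ => contourSum_sub (hΦ (Fin.succ i)) (hΨ (Fin.succ i)),
      ← smul_add, Finset.sum_sub_distrib, Fin.sum_univ_succ (n := 7), Fin.sum_univ_succ (n := 7)]
    simp only [odotR_e_zero, mul_e_zero]
    exact congrArg _ (add_add_sub_cancel _ _ _).symm
  · have hpt (z dz : ℂ) :
        ∑ i : Fin 8, odotR (odotR (rinvR (rmo (toSlice J z) - T))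
          (-(toSlice J dz) * J * toSlice J (Fc i z))) (e i) =
        odotR (rinvR (rmo (toSlice J z) - T))
          (-(toSlice J dz) * J * toSlice J (F₀ z + F₁ z * Complex.I)) := by
      rw [neg_toSlice_mul_self hJ, hstem]
      exact sum_odotR_stemFamily hJ hc hc0 F₀ F₁ _ z _
    have hsum_int := ContourIntegrable.sum Finset.univ fun i _ => hΦ i
    simp only [hpt] at hsum hsum_int
    refine ⟨hsum, fun v hv => ?_⟩
    have hv' := clm_contourSum (ContinuousLinearMap.apply ℝ V v) hsum_int
    simp only [ContinuousLinearMap.apply_apply] at hv'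
    rw [hsum, smul_apply, hv']
    simp only [rinvR, odotR_extO_apply_of_mem_ReSet _ _ hv]
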